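/- In a finite graph, let P1 and P2 be two paths that share a common vertex z, and let R1 and R2 be subpaths of P1 and P2 respectively, both having z as an endpoint, such that the vertex intersection of R1 with P2 equals {z} and the vertex intersection of R2 with P1 equals {z}. If there exists a path P not containing z such that the vertex set of P intersects P1 in a nonempty set contained in R1, and intersects P2 in a nonempty set contained in R2, then P1 and P2 cannot both be longest paths. -/

import Mathlib

open SimpleGraph

namespace SimpleGraph.Walk

/-- `R` is a prefix of the walk `P`. -/
def IsPrefixOf {V : Type*} {G : SimpleGraph V} {u v w x : V}
    (R : G.Walk u v) (P : G.Walk w x) : Prop :=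
  ∃ (hu : u = w) (Q : G.Walk v x), P = (R.copy hu rfl).append Q

/-- `R` is a suffix of the walk `P`. -/
def IsSuffixOf {V : Type*} {G : SimpleGraph V} {u v w x : V}
    (R : G.Walk u v) (P : G.Walk w x) : Prop :=
  ∃ (hv : v = x) (Q : G.Walk w u), P = Q.append (R.copy rfl hv)

/-- `R` is a tail of `P`: a subpath of `P` containing an endpoint of `P`
(up to orientation). -/
def IsTailOf {V : Type*} {G : SimpleGraph V} {u v w x : V}
    (R : G.Walk u v) (P : G.Walk w x) : Prop :=
  R.IsPrefixOf P ∨ R.IsSuffixOf P ∨ R.reverse.IsPrefixOf P ∨ R.reverse.IsSuffixOf P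

/-- `R` is an infix of the walk `P`. -/
def IsInfixOf {V : Type*} {G : SimpleGraph V} {u v w x : V}
    (R : G.Walk u v) (P : G.Walk w x) : Prop :=
  ∃ (Q₁ : G.Walk w u) (Q₂ : G.Walk v x), P = Q₁.append (R.append Q₂)

/-- `R` is a subpath of `P` (an infix, up to orientation). -/
def IsSubpathOf {V : Type*} {G : SimpleGraph V} {u v w x : V}
    (R : G.Walk u v) (P : G.Walk w x) : Prop :=
  R.IsInfixOf P ∨ R.reverse.IsInfixOf P

/-- `R` is one of the two tails of `P` obtained by splitting `P` at the vertex `z`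
(up to orientation). -/
def IsTailFrom {V : Type*} {G : SimpleGraph V} (z : V) {u v w x : V}
    (R : G.Walk u v) (P : G.Walk w x) : Prop :=
  (R.IsPrefixOf P ∧ v = z) ∨ (R.IsSuffixOf P ∧ u = z) ∨
  (R.reverse.IsPrefixOf P ∧ u = z) ∨ (R.reverse.IsSuffixOf P ∧ v = z)

end SimpleGraph.Walk

/-- A walk `p` is a longest path in `G` if it is a path and no path in `G` is longer. -/
def IsLongestPath {V : Type*} (G : SimpleGraph V) {a b : V} (p : G.Walk a b) : Prop :=
  p.IsPath ∧ ∀ (c d : V) (q : G.Walk c d), q.IsPath → q.length ≤ p.length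

theorem aux_isPath_append {V : Type} {G : SimpleGraph V} {u v w : V} {p : G.Walk u v}
    {q : G.Walk v w} (hp : p.IsPath) (hq : q.IsPath)
    (h : ∀ x, x ∈ p.support → x ∈ q.support → x = v) : (p.append q).IsPath := by
  rw [Walk.isPath_def, Walk.support_append, List.nodup_append]
  have hq' := hq.support_nodup
  rw [Walk.support_eq_cons, List.nodup_cons] at hq'
  refine ⟨hp.support_nodup, hq'.2, ?_⟩
  rintro a ha b hb rfl
  have := h a ha (List.mem_of_mem_tail hb)
  subst this
  exact hq'.1 hb

theorem aux_append {V : Type} {G : SimpleGraph V} {u v w : V} {p : G.Walk u v}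
    {q : G.Walk v w} (h : (p.append q).IsPath) :
    p.IsPath ∧ q.IsPath ∧ ∀ x, x ∈ p.support → x ∈ q.support → x = v := by
  refine ⟨h.of_append_left, h.of_append_right, ?_⟩
  intro x hx hx'
  have h' := h.support_nodup
  rw [Walk.support_append, List.nodup_append] at h'
  rw [Walk.support_eq_cons, List.mem_cons] at hx'
  rcases hx' with h1 | h1
  · exact h1
  · exact absurd rfl (h'.2.2 x hx x h1)

theorem aux_split {V : Type} {G : SimpleGraph V} {a b z d x : V} (P : G.Walk a b)
    (hP : P.IsPath) (R : G.Walk z d) (hR : R.IsSubpathOf P) (hx : x ∈ R.support) :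
    ∃ (a' b' : V) (A : G.Walk a' z) (B : G.Walk z x) (C : G.Walk x b'),
      (A.append (B.append C)).IsPath ∧ (A.append (B.append C)).length = P.length ∧
      (∀ v, v ∈ (A.append (B.append C)).support ↔ v ∈ P.support) ∧
      ∀ v, v ∈ B.support → v ∈ R.support := by
  classical
  have main : ∀ {a b : V} (P : G.Walk a b), P.IsPath → R.IsInfixOf P → 
    ∃ (a' b' : V) (A : G.Walk a' z) (B : G.Walk z x) (C : G.Walk x b'),
      (A.append (B.append C)).IsPath ∧ (A.append (B.append C)).length = P.length ∧
      (∀ v, v ∈ (A.append (B.append C)).support ↔ v ∈ P.support) ∧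
      ∀ v, v ∈ B.support → v ∈ R.support := by
    rintro a b P hP ⟨Q1, Q2, h⟩
    have e : Q1.append ((R.takeUntil x hx).append ((R.dropUntil x hx).append Q2)) = P := by
      rw [h, Walk.append_assoc (R.takeUntil x hx), Walk.take_spec]
    refine ⟨a, b, Q1, R.takeUntil x hx, (R.dropUntil x hx).append Q2, ?_, ?_, ?_, ?_⟩
    · rw [e]; exact hP
    · rw [e]
    · rw [e]; exact fun _ => Iff.rfl
    · exact fun v hv => Walk.support_takeUntil_subset_support _ _ hv
  rcases hR with hR | ⟨Q1, Q2, h⟩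
  · exact main P hP hR
  · have := main P.reverse hP.reverse ⟨Q2.reverse, Q1.reverse, by
      rw [h]; simp [Walk.reverse_append, Walk.append_assoc]⟩
    simpa using this

theorem aux_conn {V : Type} {G : SimpleGraph V} {e f : V} (P : G.Walk e f) (S T : V → Prop)
    (hS : ∃ v, v ∈ P.support ∧ S v) (hT : ∃ v, v ∈ P.support ∧ T v) :
    ∃ (x y : V) (Q : G.Walk x y), Q.IsPath ∧ S x ∧ T y ∧ (∀ v, v ∈ Q.support → v ∈ P.support) ∧
      (∀ v, v ∈ Q.support → S v → v = x) ∧ (∀ v, v ∈ Q.support → T v → v = y) := by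
  classical
  have hex : ∃ n, ∃ (x y : V) (Q : G.Walk x y), Q.IsPath ∧ S x ∧ T y ∧
      (∀ v, v ∈ Q.support → v ∈ P.support) ∧ Q.length = n := by
    obtain ⟨x, hx, hSx⟩ := hS
    obtain ⟨y, hy, hTy⟩ := hT
    refine ⟨_, x, y, ((P.takeUntil x hx).reverse.append (P.takeUntil y hy)).bypass,
      Walk.bypass_isPath _, hSx, hTy, ?_, rfl⟩
    intro v hv
    have := Walk.support_bypass_subset_support _ hv
    rw [Walk.mem_support_append_iff, Walk.support_reverse, List.mem_reverse] at this
    rcases this with h | h <;> exact Walk.support_takeUntil_subset_support _ _ h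
  obtain ⟨x, y, Q, hQ, hx, hy, hsub, hlen⟩ := Nat.find_spec hex
  refine ⟨x, y, Q, hQ, hx, hy, hsub, ?_, ?_⟩
  · intro v hv hSv
    have h1 := Nat.find_min' hex ⟨v, y, Q.dropUntil v hv, hQ.dropUntil hv, hSv, hy,
      fun w hw => hsub w (Walk.support_dropUntil_subset_support _ _ hw), rfl⟩
    have h2 := congrArg Walk.length (Q.take_spec hv)
    rw [Walk.length_append] at h2
    exact (Walk.eq_of_length_eq_zero (p := Q.takeUntil v hv) (by omega)).symm
  · intro v hv hTv
    have h1 := Nat.find_min' hex ⟨x, v, Q.takeUntil v hv, hQ.takeUntil hv, hx, hTv,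
      fun w hw => hsub w (Walk.support_takeUntil_subset_support _ _ hw), rfl⟩
    have h2 := congrArg Walk.length (Q.take_spec hv)
    rw [Walk.length_append] at h2
    exact (Walk.eq_of_length_eq_zero (p := Q.dropUntil v hv) (by omega))

theorem aux_swap {V : Type} {G : SimpleGraph V} {a b z x y : V} (A : G.Walk a z)
    (B : G.Walk z x) (C : G.Walk x b) (D : G.Walk z y) (Q : G.Walk y x)
    (h : (A.append (B.append C)).IsPath) (hD : D.IsPath) (hQ : Q.IsPath) (hxz : x ≠ z)
    (hDP : ∀ v, v ∈ D.support → v ∈ (A.append (B.append C)).support → v = z)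
    (hQP : ∀ v, v ∈ Q.support → v ∈ (A.append (B.append C)).support → v = x)
    (hDQ : ∀ v, v ∈ D.support → v ∈ Q.support → v = y) :
    ∃ W : G.Walk a b, W.IsPath ∧
      W.length + B.length = (A.append (B.append C)).length + D.length + Q.length := by
  obtain ⟨hA, hBC, hABC⟩ := aux_append h
  obtain ⟨hB, hC, hBC'⟩ := aux_append hBC
  simp only [Walk.mem_support_append_iff] at hDP hQP hABC
  have hzB := B.start_mem_support
  have hxB := B.end_mem_support
  refine ⟨A.append (D.append (Q.append C)), ?_, by simp only [Walk.length_append]; omega⟩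
  have hzC : z ∉ C.support := fun hz => hxz (hBC' z hzB hz).symm
  have hxA : x ∉ A.support := fun hx => hxz (hABC x hx (Or.inl hxB))
  refine aux_isPath_append hA (aux_isPath_append hD (aux_isPath_append hQ hC ?_) ?_) ?_
  · intro v hv hv'
    exact hQP v hv (Or.inr (Or.inr hv'))
  · intro v hv hv'
    rw [Walk.mem_support_append_iff] at hv'
    rcases hv' with h1 | h1
    · exact hDQ v hv h1
    · have := hDP v hv (Or.inr (Or.inr h1))
      subst this
      exact absurd h1 hzC
  · intro v hv hv'
    simp only [Walk.mem_support_append_iff] at hv'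
    rcases hv' with h1 | h1 | h1
    · exact hDP v h1 (Or.inl hv)
    · have := hQP v h1 (Or.inl hv)
      subst this
      exact absurd hv hxA
    · exact hABC v hv (Or.inr h1)

/-- Two paths `P₁`, `P₂` sharing a vertex `z`, with subpaths `R₁` of `P₁` and `R₂` of `P₂`
having `z` as an endpoint, such that `R₁ ∩ P₂ = {z}` and `R₂ ∩ P₁ = {z}`, cannot both be
longest paths if there is a connecting path `P` avoiding `z` that meets `P₁` in a nonempty
set of vertices inside `R₁` and meets `P₂` in a nonempty set of vertices inside `R₂`. -/
theorem not_both_longest_of_connecting_path' {V : Type} [Fintype V] {G : SimpleGraph V}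
    {a₁ b₁ a₂ b₂ d₁ d₂ e f z : V}
    (P₁ : G.Walk a₁ b₁) (P₂ : G.Walk a₂ b₂) (hP₁ : P₁.IsPath) (hP₂ : P₂.IsPath)
    (hz₁ : z ∈ P₁.support) (hz₂ : z ∈ P₂.support)
    (R₁ : G.Walk z d₁) (R₂ : G.Walk z d₂)
    (hR₁ : R₁.IsSubpathOf P₁) (hR₂ : R₂.IsSubpathOf P₂)
    (hint₁ : {v : V | v ∈ R₁.support ∧ v ∈ P₂.support} = {z})
    (hint₂ : {v : V | v ∈ R₂.support ∧ v ∈ P₁.support} = {z})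
    (P : G.Walk e f) (hP : P.IsPath) (hzP : z ∉ P.support)
    (hne₁ : ∃ v, v ∈ P.support ∧ v ∈ P₁.support)
    (hsub₁ : ∀ v, v ∈ P.support → v ∈ P₁.support → v ∈ R₁.support)
    (hne₂ : ∃ v, v ∈ P.support ∧ v ∈ P₂.support)
    (hsub₂ : ∀ v, v ∈ P.support → v ∈ P₂.support → v ∈ R₂.support) :
    ¬ (IsLongestPath G P₁ ∧ IsLongestPath G P₂) := by
  rintro ⟨⟨-, hL₁⟩, ⟨-, hL₂⟩⟩
  have hi₁ : ∀ v, v ∈ R₁.support → v ∈ P₂.support → v = z := fun v h h' => by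
    have : v ∈ {v : V | v ∈ R₁.support ∧ v ∈ P₂.support} := ⟨h, h'⟩
    rwa [hint₁] at this
  have hi₂ : ∀ v, v ∈ R₂.support → v ∈ P₁.support → v = z := fun v h h' => by
    have : v ∈ {v : V | v ∈ R₂.support ∧ v ∈ P₁.support} := ⟨h, h'⟩
    rwa [hint₂] at this
  obtain ⟨x, y, Q, hQ, hx, hy, hQP, hQ₁, hQ₂⟩ :=
    aux_conn P (fun v => v ∈ P₁.support) (fun v => v ∈ P₂.support) hne₁ hne₂
  have hxP := hQP x Q.start_mem_support
  have hyP := hQP y Q.end_mem_support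
  have hxR := hsub₁ x hxP hx
  have hyR := hsub₂ y hyP hy
  have hxz : x ≠ z := fun h => hzP (h ▸ hxP)
  have hyz : y ≠ z := fun h => hzP (h ▸ hyP)
  obtain ⟨a, b, A, B, C, hp, hl, hs, hB⟩ := aux_split P₁ hP₁ R₁ hR₁ hxR
  obtain ⟨a', b', A', B', C', hp', hl', hs', hB'⟩ := aux_split P₂ hP₂ R₂ hR₂ hyR
  have hBp := hp.of_append_right.of_append_left
  have hBp' := hp'.of_append_right.of_append_left
  have hB1 : ∀ v, v ∈ B.support → v ∈ P₁.support := fun v hv =>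
    (hs v).1 (by simp only [Walk.mem_support_append_iff]; exact Or.inr (Or.inl hv))
  have hB2 : ∀ v, v ∈ B'.support → v ∈ P₂.support := fun v hv =>
    (hs' v).1 (by simp only [Walk.mem_support_append_iff]; exact Or.inr (Or.inl hv))
  have hrev : ∀ v, v ∈ Q.reverse.support → v ∈ Q.support := fun v hv => by simpa using hv
  obtain ⟨W, hW, hWl⟩ := aux_swap A B C B' Q.reverse hp hBp' hQ.reverse hxz
    (fun v h h' => hi₂ v (hB' v h) ((hs v).1 h'))
    (fun v h h' => hQ₁ v (hrev v h) ((hs v).1 h'))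
    (fun v h h' => hQ₂ v (hrev v h') (hB2 v h))
  obtain ⟨W', hW', hWl'⟩ := aux_swap A' B' C' B Q hp' hBp hQ hyz
    (fun v h h' => hi₁ v (hB v h) ((hs' v).1 h'))
    (fun v h h' => hQ₂ v h ((hs' v).1 h'))
    (fun v h h' => hQ₁ v h' (hB1 v h))
  have l1 := hL₁ _ _ W hW
  have l2 := hL₂ _ _ W' hW'
  rw [Walk.length_reverse] at hWl
  have h0 : Q.length = 0 := by omega
  have hxy : x = y := Walk.eq_of_length_eq_zero h0
  subst hxy
  exact hxz (hi₁ x hxR hy)
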